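/- There exists an absolute constant C > 0 such that the following holds: if ω : ℝ² → ℝ is integrable, d > 0, and x, x' ∈ ℝ² satisfy |x − y| ≥ d and |x' − y| ≥ d for every y in the support of ω, then |∫_{ℝ²} K(x − y) ω(y) dy − ∫_{ℝ²} K(x' − y) ω(y) dy| ≤ (C/d²) (∫_{ℝ²} |ω(y)| dy) |x − x'|. -/

import Mathlib

open MeasureTheory
open scoped RealInnerProductSpace ENNReal Classical

/-- The two-dimensional Biot–Savart kernel `K(z) = (1/(2π)) z^⊥ / |z|²`, with `K(0) = 0`. -/
noncomputable def biotSavart (z : EuclideanSpace ℝ (Fin 2)) : EuclideanSpace ℝ (Fin 2) :=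
  if z = 0 then 0 else
    (1 / (2 * Real.pi * ‖z‖ ^ 2)) • (EuclideanSpace.equiv (Fin 2) ℝ).symm ![-(z 1), z 0]

/-- Rotation by a right angle, `z ↦ z^⊥ = (-z₂, z₁)`, as a linear isometry of the plane. -/
noncomputable def perpIsometry : EuclideanSpace ℝ (Fin 2) →ₗᵢ[ℝ] EuclideanSpace ℝ (Fin 2) where
  toFun z := (EuclideanSpace.equiv (Fin 2) ℝ).symm ![-(z 1), z 0]
  map_add' z w := by
    ext i
    fin_cases i <;> simp [add_comm]
  map_smul' c z := by
    ext i
    fin_cases i <;> simp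
  norm_map' z := by
    simp [EuclideanSpace.norm_eq, Fin.sum_univ_two, add_comm]

theorem biotSavart_eq_perpIsometry (z : EuclideanSpace ℝ (Fin 2)) :
    biotSavart z = (1 / (2 * Real.pi)) • perpIsometry ((1 / ‖z‖) ^ 2 • z) := by
  by_cases hz : z = 0
  · simp [biotSavart, hz]
  · rw [biotSavart, if_neg hz, map_smul, smul_smul]
    congr 1
    field_simp

theorem measurable_biotSavart : Measurable biotSavart := by
  rw [funext biotSavart_eq_perpIsometry]
  have h : Measurable perpIsometry := perpIsometry.continuous.measurable
  fun_prop

theorem norm_biotSavart (z : EuclideanSpace ℝ (Fin 2)) :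
    ‖biotSavart z‖ = 1 / (2 * Real.pi) * (1 / ‖z‖) := by
  rw [biotSavart_eq_perpIsometry, norm_smul, perpIsometry.norm_map, norm_smul,
    Real.norm_of_nonneg (by positivity), Real.norm_of_nonneg (by positivity)]
  by_cases hz : z = 0
  · simp [hz]
  · have : ‖z‖ ≠ 0 := norm_ne_zero_iff.2 hz
    field_simp

theorem norm_biotSavart_sub_biotSavart {z w : EuclideanSpace ℝ (Fin 2)} (hz : z ≠ 0)
    (hw : w ≠ 0) :
    ‖biotSavart z - biotSavart w‖ = 1 / (2 * Real.pi) * (1 / (‖z‖ * ‖w‖)) * ‖z - w‖ := by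
  rw [biotSavart_eq_perpIsometry, biotSavart_eq_perpIsometry, ← smul_sub, ← map_sub, norm_smul,
    perpIsometry.norm_map, ← dist_eq_norm, dist_div_norm_sq_smul hz hw, dist_eq_norm,
    Real.norm_of_nonneg (by positivity), one_pow, mul_assoc]

theorem integrable_smul_biotSavart_sub {ω : EuclideanSpace ℝ (Fin 2) → ℝ} (hω : Integrable ω)
    {d : ℝ} (hd : 0 < d) {x : EuclideanSpace ℝ (Fin 2)}
    (hx : ∀ y ∈ Function.support ω, d ≤ dist x y) :
    Integrable fun y ↦ ω y • biotSavart (x - y) := by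
  refine (hω.norm.mul_const (1 / (2 * Real.pi) * (1 / d))).mono'
    (hω.aestronglyMeasurable.smul
      (measurable_biotSavart.comp (measurable_const.sub measurable_id)).aestronglyMeasurable)
    (Filter.Eventually.of_forall fun y ↦ ?_)
  by_cases hy : ω y = 0
  · simp [hy]
  · rw [norm_smul, norm_biotSavart, ← dist_eq_norm]
    have := hx y hy
    gcongr

theorem stmt6 : ∃ C > (0:ℝ),
    ∀ ω : EuclideanSpace ℝ (Fin 2) → ℝ, Integrable ω →
    ∀ d : ℝ, 0 < d → ∀ x x' : EuclideanSpace ℝ (Fin 2),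
    (∀ y ∈ Function.support ω, d ≤ dist x y) →
    (∀ y ∈ Function.support ω, d ≤ dist x' y) →
    ‖(∫ y, ω y • biotSavart (x - y)) - ∫ y, ω y • biotSavart (x' - y)‖
      ≤ C / d ^ 2 * (∫ y, |ω y|) * ‖x - x'‖ := by
  refine ⟨1 / (2 * Real.pi), by positivity, fun ω hω d hd x x' hx hx' ↦ ?_⟩
  rw [← integral_sub (integrable_smul_biotSavart_sub hω hd hx)
    (integrable_smul_biotSavart_sub hω hd hx')]
  calc ‖∫ y, (ω y • biotSavart (x - y) - ω y • biotSavart (x' - y))‖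
      ≤ ∫ y, 1 / (2 * Real.pi) / d ^ 2 * ‖x - x'‖ * |ω y| := by
        refine norm_integral_le_of_norm_le (hω.abs.const_mul _)
          (Filter.Eventually.of_forall fun y ↦ ?_)
        by_cases hy : ω y = 0
        · simp [hy]
        have hxy : d ≤ ‖x - y‖ := by simpa [dist_eq_norm] using hx y hy
        have hxy' : d ≤ ‖x' - y‖ := by simpa [dist_eq_norm] using hx' y hy
        rw [← smul_sub, norm_smul, Real.norm_eq_abs, mul_comm,
          norm_biotSavart_sub_biotSavart (norm_pos_iff.1 (hd.trans_le hxy))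
            (norm_pos_iff.1 (hd.trans_le hxy')), sub_sub_sub_cancel_right,
          div_eq_mul_one_div _ (d ^ 2), sq]
        gcongr
    _ = 1 / (2 * Real.pi) / d ^ 2 * (∫ y, |ω y|) * ‖x - x'‖ := by
        rw [integral_const_mul]
        ring
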